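/- Suppose E[G²] < ∞. Then the function χ ↦ (1−ε)·E[η_1(Z;χ)²] + ε(1+χ²) has a unique minimizer χ** over [0,∞), and as σ → 0: χ*(σ) → χ** and R(χ*(σ), σ) → (1−ε)·E[η_1(Z;χ**)²] + ε(1+(χ**)²) = M_1(ε). -/

import Mathlib

open MeasureTheory ProbabilityTheory Real Filter Set

noncomputable section

/-- The standard Gaussian measure on `ℝ`. -/
def stdGaussian : Measure ℝ := gaussianReal 0 1

/-- Soft thresholding, i.e. `η₁(u;χ) = sign(u)·max(|u|−χ,0)`. -/
def soft (u χ : ℝ) : ℝ := Real.sign u * max (|u| - χ) 0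

/-- `M₁(ε) = inf_{χ ≥ 0} [(1−ε)·E[η₁(Z;χ)²] + ε(1+χ²)]`, `Z ~ N(0,1)`. -/
def M1 (ε : ℝ) : ℝ :=
  ⨅ χ : NNReal, ((1 - ε) * ∫ z, (soft z (χ:ℝ))^2 ∂stdGaussian + ε * (1 + (χ:ℝ)^2))

/-- The law of `B`: the mixture `(1−ε)δ₀ + ε·g`. -/
def mix (ε : ℝ) (g : Measure ℝ) : Measure ℝ :=
  ENNReal.ofReal (1 - ε) • Measure.dirac (0:ℝ) + ENNReal.ofReal ε • g

/-- `R(χ,σ) = E[(η₁(B/σ+Z;χ) − B/σ)²]` with `B ~ (1−ε)δ₀+εg`, `Z ~ N(0,1)` independent. -/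
def R1 (ε : ℝ) (g : Measure ℝ) (χ σ : ℝ) : ℝ :=
  ∫ b, (∫ z, (soft (b/σ + z) χ - b/σ)^2 ∂stdGaussian) ∂(mix ε g)

/-- `ψ(χ) = (1−ε)·E[η₁(Z;χ)²] + ε(1+χ²)`. -/
def psi (ε χ : ℝ) : ℝ :=
  (1 - ε) * ∫ z, (soft z χ)^2 ∂stdGaussian + ε * (1 + χ^2)

instance : IsProbabilityMeasure stdGaussian :=
  inferInstanceAs (IsProbabilityMeasure (gaussianReal 0 1))

lemma integrable_id_stdGaussian : Integrable (fun z : ℝ => z) stdGaussian :=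
  memLp_one_iff_integrable.1 (memLp_id_gaussianReal (μ := 0) (v := 1) 1)

lemma integrable_sq_stdGaussian : Integrable (fun z : ℝ => z ^ 2) stdGaussian :=
  (memLp_id_gaussianReal (μ := 0) (v := 1) 2).integrable_sq

lemma integral_id_stdGaussian : ∫ z, z ∂stdGaussian = 0 :=
  integral_id_gaussianReal

lemma integral_sq_stdGaussian : ∫ z, z ^ 2 ∂stdGaussian = 1 := by
  have h := variance_of_integral_eq_zero (μ := stdGaussian) (X := fun z => z)
    measurable_id.aemeasurable integral_id_stdGaussian
  rw [← h]
  exact_mod_cast variance_fun_id_gaussianReal (μ := 0) (v := 1)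

lemma integral_add_sq_stdGaussian (a : ℝ) : ∫ z, (z + a) ^ 2 ∂stdGaussian = 1 + a ^ 2 := by
  have h : ∀ z : ℝ, (z + a) ^ 2 = z ^ 2 + 2 * a * z + a ^ 2 := fun z => by ring
  have h1 := integrable_sq_stdGaussian
  have h2 := integrable_id_stdGaussian.const_mul (2 * a)
  have h12 : Integrable (fun z : ℝ => z ^ 2 + 2 * a * z) stdGaussian := h1.add h2
  simp_rw [h]
  rw [integral_add h12 (integrable_const _), integral_add h1 h2, integral_const_mul,
    integral_id_stdGaussian, integral_sq_stdGaussian]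
  simp

/-- Soft thresholding as a difference of two positive parts. -/
lemma soft_eq (u : ℝ) {χ : ℝ} (hχ : 0 ≤ χ) : soft u χ = max (u - χ) 0 - max (-u - χ) 0 := by
  unfold soft
  rcases lt_trichotomy u 0 with h | h | h
  · rw [Real.sign_of_neg h, abs_of_neg h, max_eq_right (show u - χ ≤ 0 by linarith)]; ring
  · subst h; simp
  · rw [Real.sign_of_pos h, abs_of_pos h, max_eq_right (show -u - χ ≤ 0 by linarith)]; ring

lemma soft_sq (u : ℝ) {χ : ℝ} (hχ : 0 ≤ χ) : soft u χ ^ 2 = max (|u| - χ) 0 ^ 2 := by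
  rw [soft_eq u hχ]
  rcases le_total u 0 with h | h
  · rw [abs_of_nonpos h, max_eq_right (show u - χ ≤ 0 by linarith)]; ring
  · rw [abs_of_nonneg h, max_eq_right (show -u - χ ≤ 0 by linarith)]; ring

lemma soft_zero (u : ℝ) : soft u 0 = u := by
  rw [soft_eq u le_rfl]
  rcases le_total u 0 with h | h <;> simp [h]

lemma abs_soft_sub_le (u : ℝ) {χ : ℝ} (hχ : 0 ≤ χ) : |soft u χ - u| ≤ χ := by
  rw [soft_eq u hχ, abs_le]
  constructor <;> rcases max_cases (u - χ) 0 with h | h <;>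
    rcases max_cases (-u - χ) 0 with h' | h' <;> linarith

lemma abs_soft_sub_soft_le (u : ℝ) {χ χ' : ℝ} (hχ : 0 ≤ χ) (hχ' : 0 ≤ χ') :
    |soft u χ - soft u χ'| ≤ |χ - χ'| := by
  wlog h : χ ≤ χ' generalizing χ χ'
  · rw [abs_sub_comm, abs_sub_comm χ]
    exact this hχ' hχ (le_of_not_ge h)
  rw [abs_of_nonpos (sub_nonpos.2 h), soft_eq u hχ, soft_eq u hχ', abs_le]
  constructor <;> rcases max_cases (u - χ) 0 with h | h <;>
    rcases max_cases (-u - χ) 0 with h' | h' <;> rcases max_cases (u - χ') 0 with h'' | h'' <;>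
    rcases max_cases (-u - χ') 0 with h3 | h3 <;> linarith

lemma abs_soft_add_sub_le (μ z : ℝ) {χ : ℝ} (hχ : 0 ≤ χ) : |soft (μ + z) χ - μ| ≤ |z| + χ := by
  have h := abs_soft_sub_le (μ + z) hχ
  have h2 : soft (μ + z) χ - μ = z + (soft (μ + z) χ - (μ + z)) := by ring
  rw [h2]
  exact (abs_add_le _ _).trans (by linarith)

lemma min_le_abs_soft_add_sub (μ z : ℝ) {χ : ℝ} (hχ : 0 ≤ χ) :
    min |μ| χ ≤ |soft (μ + z) χ - μ| + |z| := by
  have hz := le_abs_self z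
  have hz' := neg_le_abs z
  have hz0 := abs_nonneg z
  rw [soft_eq _ hχ]
  rcases le_total (μ + z - χ) 0 with h | h
  · rcases le_total (-(μ + z) - χ) 0 with h' | h'
    · rw [max_eq_right h, max_eq_right h']
      have : |(0 : ℝ) - 0 - μ| = |μ| := by simp
      linarith [min_le_left |μ| χ]
    · rw [max_eq_right h, max_eq_left h']
      have := le_abs_self (0 - (-(μ + z) - χ) - μ)
      linarith [min_le_right |μ| χ]
  · rw [max_eq_left h, max_eq_right (by linarith)]
    have := neg_le_abs (μ + z - χ - 0 - μ)
    linarith [min_le_right |μ| χ]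

lemma soft_add_sub_sq_le (μ z : ℝ) {χ : ℝ} (hχ : 0 ≤ χ) :
    (soft (μ + z) χ - μ) ^ 2 ≤ 2 * z ^ 2 + 2 * χ ^ 2 := by
  have h := abs_soft_add_sub_le μ z hχ
  have h2 := pow_le_pow_left₀ (abs_nonneg _) h 2
  rw [sq_abs] at h2
  nlinarith [sq_nonneg (|z| - χ), sq_abs z]

lemma measurable_soft_add_sub_sq {χ : ℝ} (hχ : 0 ≤ χ) :
    Measurable (fun p : ℝ × ℝ => (soft (p.1 + p.2) χ - p.1) ^ 2) := by
  simp_rw [soft_eq _ hχ]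
  fun_prop

/-- The risk `E[(η₁(μ+Z;χ) − μ)²]` of soft thresholding at a fixed mean `μ`. -/
def softRisk (μ χ : ℝ) : ℝ := ∫ z, (soft (μ + z) χ - μ) ^ 2 ∂stdGaussian

lemma integrable_soft_bound (χ : ℝ) :
    Integrable (fun z : ℝ => 2 * z ^ 2 + 2 * χ ^ 2) stdGaussian :=
  (integrable_sq_stdGaussian.const_mul 2).add (integrable_const _)

lemma integrable_soft_add_sub_sq (μ : ℝ) {χ : ℝ} (hχ : 0 ≤ χ) :
    Integrable (fun z => (soft (μ + z) χ - μ) ^ 2) stdGaussian := by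
  refine (integrable_soft_bound χ).mono' ?_ (ae_of_all _ fun z => ?_)
  · exact ((measurable_soft_add_sub_sq hχ).comp measurable_prodMk_left).aestronglyMeasurable
  · rw [Real.norm_of_nonneg (sq_nonneg _)]
    exact soft_add_sub_sq_le μ z hχ

lemma softRisk_nonneg (μ χ : ℝ) : 0 ≤ softRisk μ χ := integral_nonneg fun _ => sq_nonneg _

lemma softRisk_le (μ : ℝ) {χ : ℝ} (hχ : 0 ≤ χ) : softRisk μ χ ≤ 2 + 2 * χ ^ 2 := by
  have h := integral_mono (integrable_soft_add_sub_sq μ hχ) (integrable_soft_bound χ)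
    fun z => soft_add_sub_sq_le μ z hχ
  rw [integral_add (integrable_sq_stdGaussian.const_mul 2) (integrable_const _),
    integral_const_mul, integral_sq_stdGaussian] at h
  simpa [softRisk] using h

lemma softRisk_zero_right (μ : ℝ) : softRisk μ 0 = 1 := by
  simp [softRisk, soft_zero, integral_sq_stdGaussian]

lemma le_softRisk (μ : ℝ) {χ : ℝ} (hχ : 0 ≤ χ) : min |μ| χ ^ 2 / 2 - 1 ≤ softRisk μ χ := by
  have h := integral_mono ((integrable_const (min |μ| χ ^ 2 / 2)).sub integrable_sq_stdGaussian)
    (integrable_soft_add_sub_sq μ hχ) fun z => by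
      have h := min_le_abs_soft_add_sub μ z hχ
      have h2 := pow_le_pow_left₀ (le_min (abs_nonneg μ) hχ) h 2
      simp only [Pi.sub_apply]
      nlinarith [sq_nonneg (|soft (μ + z) χ - μ| - |z|), sq_abs z, sq_abs (soft (μ + z) χ - μ)]
  simp only [Pi.sub_apply] at h
  rw [integral_sub (integrable_const _) integrable_sq_stdGaussian, integral_sq_stdGaussian] at h
  simpa [softRisk] using h

lemma abs_softRisk_sub_le (μ : ℝ) {χ χ' K : ℝ} (hχ : χ ∈ Icc 0 K) (hχ' : χ' ∈ Icc 0 K) :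
    |softRisk μ χ - softRisk μ χ'| ≤ (2 + 2 * K) * |χ - χ'| := by
  have hi := integrable_soft_add_sub_sq μ hχ.1
  have hi' := integrable_soft_add_sub_sq μ hχ'.1
  have hb : Integrable (fun z : ℝ => (z ^ 2 + (1 + 2 * K)) * |χ - χ'|) stdGaussian :=
    (integrable_sq_stdGaussian.add (integrable_const _)).mul_const _
  have hval : ∫ z, (z ^ 2 + (1 + 2 * K)) * |χ - χ'| ∂stdGaussian = (2 + 2 * K) * |χ - χ'| := by
    rw [integral_mul_const, integral_add integrable_sq_stdGaussian (integrable_const _),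
      integral_sq_stdGaussian]
    simp; left; ring
  unfold softRisk
  rw [← integral_sub hi hi', ← hval, ← Real.norm_eq_abs]
  refine norm_integral_le_of_norm_le hb (ae_of_all _ fun z => ?_)
  set a := soft (μ + z) χ - μ with ha
  set b := soft (μ + z) χ' - μ with hb
  have h1 : |a| ≤ |z| + K := (abs_soft_add_sub_le μ z hχ.1).trans (by linarith [hχ.2])
  have h2 : |b| ≤ |z| + K := (abs_soft_add_sub_le μ z hχ'.1).trans (by linarith [hχ'.2])
  have h3 : |a - b| ≤ |χ - χ'| := by
    have : a - b = soft (μ + z) χ - soft (μ + z) χ' := by rw [ha, hb]; ring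
    rw [this]; exact abs_soft_sub_soft_le _ hχ.1 hχ'.1
  have h4 : |a + b| ≤ z ^ 2 + (1 + 2 * K) := by
    refine (abs_add_le a b).trans ?_
    nlinarith [sq_nonneg (|z| - 1), sq_abs z]
  rw [Real.norm_eq_abs, show a ^ 2 - b ^ 2 = (a + b) * (a - b) by ring, abs_mul]
  exact mul_le_mul h4 h3 (abs_nonneg _) ((abs_nonneg _).trans h4)

lemma tendsto_softRisk_atTop {χ : ℝ} (hχ : 0 ≤ χ) :
    Tendsto (fun μ => softRisk μ χ) atTop (nhds (1 + χ ^ 2)) := by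
  have hlim : ∫ z, (z + -χ) ^ 2 ∂stdGaussian = 1 + χ ^ 2 := by
    rw [integral_add_sq_stdGaussian, neg_sq]
  rw [← hlim]
  refine tendsto_integral_filter_of_dominated_convergence _
    (Eventually.of_forall fun μ => (integrable_soft_add_sub_sq μ hχ).1)
    (Eventually.of_forall fun μ => ae_of_all _ fun z => ?_) (integrable_soft_bound χ)
    (ae_of_all _ fun z => ?_)
  · rw [Real.norm_of_nonneg (sq_nonneg _)]
    exact soft_add_sub_sq_le μ z hχ
  · refine tendsto_const_nhds.congr' ?_
    filter_upwards [eventually_ge_atTop (χ - z)] with μ hμ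
    rw [soft_eq _ hχ, max_eq_left (by linarith), max_eq_right (by linarith)]
    ring

lemma tendsto_softRisk_atBot {χ : ℝ} (hχ : 0 ≤ χ) :
    Tendsto (fun μ => softRisk μ χ) atBot (nhds (1 + χ ^ 2)) := by
  rw [← integral_add_sq_stdGaussian χ]
  refine tendsto_integral_filter_of_dominated_convergence _
    (Eventually.of_forall fun μ => (integrable_soft_add_sub_sq μ hχ).1)
    (Eventually.of_forall fun μ => ae_of_all _ fun z => ?_) (integrable_soft_bound χ)
    (ae_of_all _ fun z => ?_)
  · rw [Real.norm_of_nonneg (sq_nonneg _)]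
    exact soft_add_sub_sq_le μ z hχ
  · refine tendsto_const_nhds.congr' ?_
    filter_upwards [eventually_le_atBot (-χ - z)] with μ hμ
    rw [soft_eq _ hχ, max_eq_right (by linarith), max_eq_left (by linarith)]
    ring

lemma tendsto_softRisk_div {b χ : ℝ} (hb : b ≠ 0) (hχ : 0 ≤ χ) :
    Tendsto (fun σ => softRisk (b / σ) χ) (nhdsWithin 0 (Ioi 0)) (nhds (1 + χ ^ 2)) := by
  rcases hb.lt_or_gt with h | h
  · exact (tendsto_softRisk_atBot hχ).comp (tendsto_inv_nhdsGT_zero.const_mul_atTop_of_neg h)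
  · exact (tendsto_softRisk_atTop hχ).comp (tendsto_inv_nhdsGT_zero.const_mul_atTop h)

lemma measurable_softRisk {χ : ℝ} (hχ : 0 ≤ χ) : Measurable (fun μ => softRisk μ χ) :=
  ((measurable_soft_add_sub_sq hχ).stronglyMeasurable.integral_prod_right (ν := stdGaussian)
    ).measurable

section Mixture

variable {ε : ℝ} {g : Measure ℝ} [IsProbabilityMeasure g]

lemma integrable_softRisk_div (g : Measure ℝ) [IsFiniteMeasure g] (σ : ℝ) {χ : ℝ} (hχ : 0 ≤ χ) :
    Integrable (fun b => softRisk (b / σ) χ) g := by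
  refine (integrable_const (2 + 2 * χ ^ 2)).mono'
    ((measurable_softRisk hχ).comp (measurable_id.div_const σ)).aestronglyMeasurable
    (ae_of_all _ fun b => ?_)
  rw [Real.norm_of_nonneg (softRisk_nonneg _ _)]
  exact softRisk_le _ hχ

lemma psi_eq (ε χ : ℝ) : psi ε χ = (1 - ε) * softRisk 0 χ + ε * (1 + χ ^ 2) := by
  simp [psi, softRisk]

lemma R1_eq (hε : ε ∈ Ioo (0 : ℝ) 1) {χ : ℝ} (hχ : 0 ≤ χ) (σ : ℝ) :
    R1 ε g χ σ = (1 - ε) * softRisk 0 χ + ε * ∫ b, softRisk (b / σ) χ ∂g := by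
  change ∫ b, softRisk (b / σ) χ ∂(mix ε g) = _
  unfold mix
  rw [integral_add_measure ((integrable_softRisk_div _ σ hχ).smul_measure ENNReal.ofReal_ne_top)
    ((integrable_softRisk_div _ σ hχ).smul_measure ENNReal.ofReal_ne_top),
    integral_smul_measure, integral_smul_measure, integral_dirac,
    ENNReal.toReal_ofReal (by linarith [hε.2]), ENNReal.toReal_ofReal hε.1.le]
  simp

lemma R1_zero (hε : ε ∈ Ioo (0 : ℝ) 1) (σ : ℝ) : R1 ε g 0 σ = 1 := by
  simp [R1_eq hε le_rfl, softRisk_zero_right]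

lemma abs_R1_sub_le (hε : ε ∈ Ioo (0 : ℝ) 1) (σ : ℝ) {χ χ' K : ℝ} (hχ : χ ∈ Icc 0 K)
    (hχ' : χ' ∈ Icc 0 K) :
    |R1 ε g χ σ - R1 ε g χ' σ| ≤ (2 + 2 * K) * |χ - χ'| := by
  have hε1 : 0 ≤ 1 - ε := by linarith [hε.2]
  have h1 := abs_softRisk_sub_le 0 hχ hχ'
  have h2 : |∫ b, softRisk (b / σ) χ ∂g - ∫ b, softRisk (b / σ) χ' ∂g| ≤
      (2 + 2 * K) * |χ - χ'| := by
    rw [← integral_sub (integrable_softRisk_div g σ hχ.1) (integrable_softRisk_div g σ hχ'.1),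
      ← Real.norm_eq_abs]
    refine (norm_integral_le_of_norm_le (integrable_const ((2 + 2 * K) * |χ - χ'|))
      (ae_of_all _ fun b => abs_softRisk_sub_le _ hχ hχ')).trans ?_
    simp
  rw [R1_eq hε hχ.1, R1_eq hε hχ'.1]
  rw [abs_le] at h1 h2 ⊢
  constructor <;> nlinarith [hε.1]

lemma tendsto_R1 (hε : ε ∈ Ioo (0 : ℝ) 1) (hg0 : g {0} = 0) {χ : ℝ} (hχ : 0 ≤ χ) :
    Tendsto (fun σ => R1 ε g χ σ) (nhdsWithin 0 (Ioi 0)) (nhds (psi ε χ)) := by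
  simp_rw [R1_eq hε hχ, psi_eq]
  refine tendsto_const_nhds.add (Tendsto.const_mul _ ?_)
  have hlim : ∫ _, (1 + χ ^ 2) ∂g = 1 + χ ^ 2 := by simp
  rw [← hlim]
  refine tendsto_integral_filter_of_dominated_convergence (fun _ => 2 + 2 * χ ^ 2)
    (Eventually.of_forall fun σ => (integrable_softRisk_div g σ hχ).1)
    (Eventually.of_forall fun σ => ae_of_all _ fun b => ?_) (integrable_const _) ?_
  · rw [Real.norm_of_nonneg (softRisk_nonneg _ _)]
    exact softRisk_le _ hχ
  · filter_upwards [compl_mem_ae_iff.2 hg0] with b hb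
    exact tendsto_softRisk_div hb hχ

lemma tendsto_integral_min_div (hg0 : g {0} = 0) {K : ℝ} (hK : 0 ≤ K) :
    Tendsto (fun σ => ∫ b, (min |b / σ| K ^ 2 / 2 - 1) ∂g) (nhdsWithin 0 (Ioi 0))
      (nhds (K ^ 2 / 2 - 1)) := by
  have hlim : ∫ _, (K ^ 2 / 2 - 1) ∂g = K ^ 2 / 2 - 1 := by simp
  rw [← hlim]
  refine tendsto_integral_filter_of_dominated_convergence (fun _ => K ^ 2 / 2 + 1)
    (Eventually.of_forall fun σ => ?_)
    (Eventually.of_forall fun σ => ae_of_all _ fun b => ?_) (integrable_const _) ?_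
  · exact Measurable.aestronglyMeasurable (by fun_prop)
  · have h0 : 0 ≤ min |b / σ| K := le_min (abs_nonneg _) hK
    have h1 := pow_le_pow_left₀ h0 (min_le_right |b / σ| K) 2
    rw [Real.norm_eq_abs, abs_le]
    constructor <;> nlinarith
  · filter_upwards [compl_mem_ae_iff.2 hg0] with b hb
    refine tendsto_const_nhds.congr' ?_
    have h : Tendsto (fun σ : ℝ => |b| * σ⁻¹) (nhdsWithin 0 (Ioi 0)) atTop :=
      tendsto_inv_nhdsGT_zero.const_mul_atTop (abs_pos.2 hb)
    filter_upwards [h.eventually_ge_atTop K, self_mem_nhdsWithin] with σ hσ hσ0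
    rw [abs_div, abs_of_pos (mem_Ioi.1 hσ0), min_eq_right (by rwa [div_eq_mul_inv])]

/-- Thresholds beyond a suitable level are eventually worse than no thresholding at all. -/
lemma exists_eventually_one_lt_R1 (hε : ε ∈ Ioo (0 : ℝ) 1) (hg0 : g {0} = 0) :
    ∃ K : ℝ, 0 ≤ K ∧ ∀ᶠ σ in nhdsWithin (0 : ℝ) (Ioi 0), ∀ χ, K ≤ χ → 1 < R1 ε g χ σ := by
  have hε0 := hε.1
  set K : ℝ := 2 * (1 / ε + 1) with hKdef
  have hinv : 0 < 1 / ε := by positivity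
  have hK : 0 ≤ K := by positivity
  have hK2 : 1 / ε < K ^ 2 / 2 - 1 := by rw [hKdef]; nlinarith
  refine ⟨K, hK, ?_⟩
  filter_upwards [(tendsto_integral_min_div (g := g) hg0 hK).eventually_const_lt hK2]
    with σ hσ χ hχ
  have hχ0 := hK.trans hχ
  have hle : ∫ b, (min |b / σ| K ^ 2 / 2 - 1) ∂g ≤ ∫ b, softRisk (b / σ) χ ∂g := by
    have hint : Integrable (fun b => min |b / σ| K ^ 2 / 2 - 1) g :=
      .of_integral_ne_zero (hinv.trans hσ).ne'
    refine integral_mono hint (integrable_softRisk_div g σ hχ0) fun b => ?_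
    have h0 : 0 ≤ min |b / σ| K := le_min (abs_nonneg _) hK
    have h1 := pow_le_pow_left₀ h0 (min_le_min_left |b / σ| hχ) 2
    exact le_trans (by linarith) (le_softRisk (b / σ) hχ0)
  rw [R1_eq hε hχ0]
  have h1 : 0 ≤ (1 - ε) * softRisk 0 χ :=
    mul_nonneg (by linarith [hε.2]) (softRisk_nonneg _ _)
  have h2 : ε * (1 / ε) < ε * ∫ b, softRisk (b / σ) χ ∂g :=
    mul_lt_mul_of_pos_left (hσ.trans_le hle) hε0
  rw [mul_one_div_cancel hε0.ne'] at h2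
  linarith

end Mixture

lemma psi_minimizer_unique {ε : ℝ} (hε : ε ∈ Ioo (0 : ℝ) 1) {c c' : ℝ} (hc : 0 ≤ c)
    (hc' : 0 ≤ c') (hm : IsMinOn (psi ε) (Ici 0) c) (hm' : IsMinOn (psi ε) (Ici 0) c') :
    c' = c := by
  have hmid : 0 ≤ (c + c') / 2 := by positivity
  have h1 := isMinOn_iff.1 hm _ (mem_Ici.2 hmid)
  have h2 := isMinOn_iff.1 hm' _ (mem_Ici.2 hmid)
  have hrisk : softRisk 0 ((c + c') / 2) ≤ (softRisk 0 c + softRisk 0 c') / 2 := by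
    have hi := integrable_soft_add_sub_sq 0 hc
    have hi' := integrable_soft_add_sub_sq 0 hc'
    unfold softRisk
    rw [← integral_add hi hi', ← integral_div]
    refine integral_mono (integrable_soft_add_sub_sq 0 hmid) ((hi.add hi').div_const 2) fun z => ?_
    simp only [zero_add, sub_zero, soft_sq _ hmid, soft_sq _ hc, soft_sq _ hc']
    have h : max (|z| - (c + c') / 2) 0 ≤ (max (|z| - c) 0 + max (|z| - c') 0) / 2 :=
      max_le (by linarith [le_max_left (|z| - c) 0, le_max_left (|z| - c') 0])
        (by linarith [le_max_right (|z| - c) 0, le_max_right (|z| - c') 0])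
    have h3 := pow_le_pow_left₀ (le_max_right _ _) h 2
    nlinarith [sq_nonneg (max (|z| - c) 0 - max (|z| - c') 0)]
  rw [psi_eq, psi_eq] at h1 h2
  have h3 := mul_le_mul_of_nonneg_left hrisk (show 0 ≤ 1 - ε by linarith [hε.2])
  have h4 : ε * (c' - c) ^ 2 ≤ 0 := by nlinarith
  have h5 : (c' - c) ^ 2 ≤ 0 := nonpos_of_mul_nonpos_right h4 hε.1
  have h6 : c' - c = 0 := pow_eq_zero_iff two_ne_zero |>.1 (le_antisymm h5 (sq_nonneg _))
  linarith

lemma psi_eq_M1_of_isMinOn {ε c : ℝ} (hc : 0 ≤ c) (hm : IsMinOn (psi ε) (Ici 0) c) :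
    psi ε c = M1 ε := by
  change psi ε c = ⨅ χ : NNReal, psi ε χ
  have hle : ∀ χ : NNReal, psi ε c ≤ psi ε χ := fun χ => isMinOn_iff.1 hm _ χ.2
  exact le_antisymm (le_ciInf hle)
    (ciInf_le ⟨psi ε c, by rintro _ ⟨χ, rfl⟩; exact hle χ⟩ (⟨c, hc⟩ : NNReal))

/-- Cluster points of minimizers of the risk `R1 ε g · σ` as `σ → 0⁺` minimize `psi ε`. -/
lemma isMinOn_psi_of_mapClusterPt {ε : ℝ} (hε : ε ∈ Ioo (0 : ℝ) 1) {g : Measure ℝ}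
    [IsProbabilityMeasure g] (hg0 : g {0} = 0) {χstar : ℝ → ℝ}
    (hχstar : ∀ σ, 0 < σ → χstar σ ∈ Ici (0 : ℝ) ∧
      IsMinOn (fun χ => R1 ε g χ σ) (Ici 0) (χstar σ))
    {x : ℝ} (hx : 0 ≤ x) (hcl : MapClusterPt x (nhdsWithin (0 : ℝ) (Ioi 0)) χstar) :
    IsMinOn (psi ε) (Ici 0) x := by
  refine isMinOn_iff.2 fun y hy => le_of_forall_pos_le_add fun δ hδ => ?_
  set L : ℝ := 2 + 2 * (x + 1) with hL
  have hL0 : 0 < L := by positivity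
  set η : ℝ := min 1 (δ / (3 * L)) with hη
  have hη0 : 0 < η := by positivity
  have hηL : L * η ≤ δ / 3 := by
    calc L * η ≤ L * (δ / (3 * L)) := mul_le_mul_of_nonneg_left (min_le_right _ _) hL0.le
      _ = δ / 3 := by field_simp
  have hfreq := hcl.frequently (Metric.ball_mem_nhds x hη0)
  have hev1 := (tendsto_R1 (g := g) hε hg0 hx).eventually_const_lt
    (show psi ε x - δ / 3 < psi ε x by linarith)
  have hev2 := (tendsto_R1 (g := g) hε hg0 (mem_Ici.1 hy)).eventually_lt_const
    (show psi ε y < psi ε y + δ / 3 by linarith)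
  obtain ⟨σ, hball, h1, h2, hσ⟩ :=
    (hfreq.and_eventually (hev1.and (hev2.and self_mem_nhdsWithin))).exists
  obtain ⟨hpos, hmin⟩ := hχstar σ hσ
  have hdist : |x - χstar σ| < η := by
    rwa [abs_sub_comm, ← Real.dist_eq]
  have h3 : R1 ε g (χstar σ) σ ≤ R1 ε g y σ := isMinOn_iff.1 hmin y hy
  have h4 := (le_abs_self _).trans (abs_R1_sub_le (g := g) hε σ (K := x + 1)
    (show x ∈ Icc 0 (x + 1) from ⟨hx, by linarith⟩)
    (show χstar σ ∈ Icc 0 (x + 1) from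
      ⟨hpos, by linarith [(abs_lt.1 hdist).1, min_le_left 1 (δ / (3 * L))]⟩))
  have h5 : L * |x - χstar σ| ≤ L * η := mul_le_mul_of_nonneg_left hdist.le hL0.le
  linarith

/-- If `E[G²] < ∞` then `χ ↦ (1−ε)E[η₁(Z;χ)²]+ε(1+χ²)` has a unique minimizer `χ**` over
`[0,∞)`, and as `σ → 0⁺`: `χ*(σ) → χ**` and `R(χ*(σ),σ) → ψ(χ**) = M₁(ε)`, where `χ*(σ)`
is the minimizer of `χ ↦ R(χ,σ)` over `[0,∞)`. -/
theorem chi_star_and_risk_limit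
    (ε : ℝ) (hε : ε ∈ Ioo (0:ℝ) 1)
    (g : Measure ℝ) [IsProbabilityMeasure g] (hg0 : g {0} = 0)
    (hG2 : Integrable (fun x => x^2) g)
    (χstar : ℝ → ℝ)
    (hχstar : ∀ σ, 0 < σ → χstar σ ∈ Ici (0:ℝ) ∧
      IsMinOn (fun χ => R1 ε g χ σ) (Ici 0) (χstar σ)) :
    ∃ c : ℝ, c ∈ Ici (0:ℝ) ∧ IsMinOn (psi ε) (Ici 0) c ∧
      (∀ c' ∈ Ici (0:ℝ), IsMinOn (psi ε) (Ici 0) c' → c' = c) ∧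
      Tendsto χstar (nhdsWithin (0:ℝ) (Ioi 0)) (nhds c) ∧
      Tendsto (fun σ => R1 ε g (χstar σ) σ) (nhdsWithin (0:ℝ) (Ioi 0)) (nhds (psi ε c)) ∧
      psi ε c = M1 ε := by
  obtain ⟨K, hK, hKev⟩ := exists_eventually_one_lt_R1 hε hg0
  have hmem : ∀ᶠ σ in nhdsWithin (0 : ℝ) (Ioi 0), χstar σ ∈ Icc 0 K := by
    filter_upwards [hKev, self_mem_nhdsWithin] with σ hσ hσ0
    obtain ⟨hpos, hmin⟩ := hχstar σ hσ0
    refine ⟨hpos, le_of_not_ge fun h => ?_⟩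
    have h0 : R1 ε g (χstar σ) σ ≤ R1 ε g 0 σ := isMinOn_iff.1 hmin 0 self_mem_Ici
    rw [R1_zero hε] at h0
    exact absurd (hσ _ h) h0.not_gt
  obtain ⟨c, hcK, hcl⟩ := isCompact_Icc.exists_mapClusterPt_of_frequently hmem.frequently
  have hmin := isMinOn_psi_of_mapClusterPt hε hg0 hχstar hcK.1 hcl
  have huniq : ∀ c' ∈ Ici (0:ℝ), IsMinOn (psi ε) (Ici 0) c' → c' = c := fun c' hc' hm' =>
    psi_minimizer_unique hε hcK.1 hc' hmin hm'
  have hlim : Tendsto χstar (nhdsWithin (0:ℝ) (Ioi 0)) (nhds c) :=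
    isCompact_Icc.tendsto_nhds_of_unique_mapClusterPt hmem fun x hx hxcl =>
      huniq x hx.1 (isMinOn_psi_of_mapClusterPt hε hg0 hχstar hx.1 hxcl)
  refine ⟨c, hcK.1, hmin, huniq, hlim, ?_, psi_eq_M1_of_isMinOn hcK.1 hmin⟩
  have hdiff : Tendsto (fun σ => R1 ε g (χstar σ) σ - R1 ε g c σ) (nhdsWithin (0:ℝ) (Ioi 0))
      (nhds 0) := by
    have hbound : Tendsto (fun σ => (2 + 2 * K) * |χstar σ - c|) (nhdsWithin (0:ℝ) (Ioi 0))
        (nhds 0) := by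
      simpa using ((hlim.sub_const c).abs).const_mul (2 + 2 * K)
    refine squeeze_zero_norm' ?_ hbound
    filter_upwards [hmem] with σ hσ
    exact abs_R1_sub_le hε σ hσ hcK
  simpa using hdiff.add (tendsto_R1 (g := g) hε hg0 hcK.1)
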